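/- Approximate microcanonical channel operators capture i.i.d. channels with compatible constraints: Fix n ≥ 1, Hermitian matrices C^1,…,C^J on ℂ^{d_B}⊗ℂ^{d_R}, reals q_1,…,q_J, and positive parameters η, ε, δ, y, ν, η′, ε′, δ′, y′, ν′, and let P be an (η,ε,δ,y,ν,η′,ε′,δ′,y′,ν′)-approximate microcanonical channel operator with respect to the C^j, q_j. Let N be a Choi matrix on ℂ^{d_B}⊗ℂ^{d_R} with tr(C^j N) = q_j for all j, and assume 2·‖C^j‖²·log(2/δ′) ≤ n·(η′)²·(y′)² for all j, where ‖·‖ is the operator norm (largest singular value). Then for every density matrix σ on ℂ^{d_R} with σ ≥ ν′y′·1, one has tr[ (1−P) · ( (1_B⊗√σ) N (1_B⊗√σ) )^{⊗n} ] ≤ ε′, where the n-fold Kronecker power is taken with tensor factors reordered to act on (ℂ^{d_B})^{⊗n}⊗(ℂ^{d_R})^{⊗n}. -/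

import Mathlib

/-! Statement 18: Approximate microcanonical channel operators capture i.i.d. channels with compatible constraints. -/

noncomputable section
open scoped Kronecker ComplexOrder
open Matrix

namespace ThermalPaper

/-- Functional calculus for Hermitian matrices (junk value `0` on non-Hermitian input). -/
def hermCFC {n : Type*} [Fintype n] [DecidableEq n] (f : ℝ → ℝ)
    (A : Matrix n n ℂ) : Matrix n n ℂ :=
  if hA : A.IsHermitian then
    (hA.eigenvectorUnitary : Matrix n n ℂ) *
      Matrix.diagonal (fun i => (f (hA.eigenvalues i) : ℂ)) *
      star (hA.eigenvectorUnitary : Matrix n n ℂ)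
  else 0

/-- Matrix logarithm of a Hermitian matrix, with the convention `log 0 = 0`. -/
def matLog {n : Type*} [Fintype n] [DecidableEq n] (A : Matrix n n ℂ) : Matrix n n ℂ :=
  hermCFC Real.log A

/-- Positive semidefinite square root of a positive semidefinite matrix. -/
def matSqrt {n : Type*} [Fintype n] [DecidableEq n] (A : Matrix n n ℂ) : Matrix n n ℂ :=
  hermCFC Real.sqrt A

/-- `X^{-1/2}`: the PSD square root of the Moore–Penrose pseudoinverse of `X`. -/
def matPinvSqrt {n : Type*} [Fintype n] [DecidableEq n] (A : Matrix n n ℂ) : Matrix n n ℂ :=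
  hermCFC (fun x => Real.sqrt x⁻¹) A

/-- The spectral projection of a Hermitian matrix onto the eigenvalues
*outside* the interval `[a, b]` (i.e. `{H ∉ [a,b]}`). -/
def specProjOutside {n : Type*} [Fintype n] [DecidableEq n] (a b : ℝ)
    (A : Matrix n n ℂ) : Matrix n n ℂ :=
  hermCFC (fun x => if a ≤ x ∧ x ≤ b then 0 else 1) A

/-- The operator norm (largest singular value) of a Hermitian matrix: the largest
absolute value of an eigenvalue (junk value `0` on non-Hermitian input). -/
def hermNorm {n : Type*} [Fintype n] [DecidableEq n] (A : Matrix n n ℂ) : ℝ :=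
  if hA : A.IsHermitian then ⨆ i, |hA.eigenvalues i| else 0

/-- Von Neumann entropy `S(X) = −tr(X log X)`. -/
def vnEnt {n : Type*} [Fintype n] [DecidableEq n] (A : Matrix n n ℂ) : ℝ :=
  -(Matrix.trace (A * matLog A)).re

/-- A density matrix: positive semidefinite with unit trace. -/
def IsDensity {n : Type*} [Fintype n] [DecidableEq n] (ρ : Matrix n n ℂ) : Prop :=
  ρ.PosSemidef ∧ Matrix.trace ρ = 1

/-- `σ ≥ c·1`: all eigenvalues of `σ` are at least `c`. -/
def opGE {n : Type*} [Fintype n] [DecidableEq n] (σ : Matrix n n ℂ) (c : ℝ) : Prop :=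
  (σ - (c : ℂ) • (1 : Matrix n n ℂ)).PosSemidef

variable {dB dR : ℕ}

/-- Partial trace over the `B` factor. -/
def ptraceB (N : Matrix (Fin dB × Fin dR) (Fin dB × Fin dR) ℂ) :
    Matrix (Fin dR) (Fin dR) ℂ :=
  Matrix.of fun r r' => ∑ b : Fin dB, N (b, r) (b, r')

/-- A Choi matrix: positive semidefinite with `tr_B N = 1`. -/
def IsChoi (N : Matrix (Fin dB × Fin dR) (Fin dB × Fin dR) ℂ) : Prop :=
  N.PosSemidef ∧ ptraceB N = 1

/-- The `n`-fold Kronecker power of a matrix on `ℂ^{d_B}⊗ℂ^{d_R}`, with tensor factors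
reordered so that it acts on `(ℂ^{d_B})^{⊗n} ⊗ (ℂ^{d_R})^{⊗n}`. -/
def kronPow {a b : ℕ} (n : ℕ) (A : Matrix (Fin a × Fin b) (Fin a × Fin b) ℂ) :
    Matrix ((Fin n → Fin a) × (Fin n → Fin b)) ((Fin n → Fin a) × (Fin n → Fin b)) ℂ :=
  Matrix.of fun p q => ∏ i : Fin n, A (p.1 i, p.2 i) (q.1 i, q.2 i)

/-- The `n`-fold Kronecker power of a matrix on `ℂ^d`, acting on `(ℂ^d)^{⊗n}`. -/
def kpow {d : ℕ} (n : ℕ) (A : Matrix (Fin d) (Fin d) ℂ) :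
    Matrix (Fin n → Fin d) (Fin n → Fin d) ℂ :=
  Matrix.of fun f g => ∏ i : Fin n, A (f i) (g i)

/-- Partial trace over the `(ℂ^{d_B})^{⊗n}` factor. -/
def ptraceBn {n : ℕ}
    (E : Matrix ((Fin n → Fin dB) × (Fin n → Fin dR)) ((Fin n → Fin dB) × (Fin n → Fin dR)) ℂ) :
    Matrix (Fin n → Fin dR) (Fin n → Fin dR) ℂ :=
  Matrix.of fun g g' => ∑ f : Fin n → Fin dB, E (f, g) (f, g')

/-- The value `E(σ^{⊗n}) = (1⊗(√σ)^{⊗n}) E (1⊗(√σ)^{⊗n})` of an `n`-copy Choi matrix on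
the i.i.d. input generated by `σ`. -/
def iidOut {n : ℕ}
    (E : Matrix ((Fin n → Fin dB) × (Fin n → Fin dR)) ((Fin n → Fin dB) × (Fin n → Fin dR)) ℂ)
    (σ : Matrix (Fin dR) (Fin dR) ℂ) :
    Matrix ((Fin n → Fin dB) × (Fin n → Fin dR)) ((Fin n → Fin dB) × (Fin n → Fin dR)) ℂ :=
  ((1 : Matrix (Fin n → Fin dB) (Fin n → Fin dB) ℂ) ⊗ₖ kpow n (matSqrt σ)) * E *
    ((1 : Matrix (Fin n → Fin dB) (Fin n → Fin dB) ℂ) ⊗ₖ kpow n (matSqrt σ))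

/-- `H^{j,σ} = (1⊗σ^{-1/2}) C^j (1⊗σ^{-1/2})`. -/
def Hwrt (Cj : Matrix (Fin dB × Fin dR) (Fin dB × Fin dR) ℂ)
    (σ : Matrix (Fin dR) (Fin dR) ℂ) :
    Matrix (Fin dB × Fin dR) (Fin dB × Fin dR) ℂ :=
  ((1 : Matrix (Fin dB) (Fin dB) ℂ) ⊗ₖ matPinvSqrt σ) * Cj *
    ((1 : Matrix (Fin dB) (Fin dB) ℂ) ⊗ₖ matPinvSqrt σ)

/-- The operator acting as `H` on the `i`-th `B` and `R` factors and as the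
identity elsewhere. -/
def embedAt {n : ℕ} (i : Fin n) (H : Matrix (Fin dB × Fin dR) (Fin dB × Fin dR) ℂ) :
    Matrix ((Fin n → Fin dB) × (Fin n → Fin dR)) ((Fin n → Fin dB) × (Fin n → Fin dR)) ℂ :=
  Matrix.of fun p q =>
    if ∀ i' : Fin n, i' ≠ i → p.1 i' = q.1 i' ∧ p.2 i' = q.2 i' then
      H (p.1 i, p.2 i) (q.1 i, q.2 i)
    else 0

/-- `H̄ = (1/n) Σ_i H_i`, the `n`-copy sample-average observable associated with `H`. -/
def avgObs (n : ℕ) (H : Matrix (Fin dB × Fin dR) (Fin dB × Fin dR) ℂ) :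
    Matrix ((Fin n → Fin dB) × (Fin n → Fin dR)) ((Fin n → Fin dB) × (Fin n → Fin dR)) ℂ :=
  ((n : ℂ))⁻¹ • ∑ i : Fin n, embedAt i H

/-- An `(η,ε,δ,y,ν,η′,ε′,δ′,y′,ν′)`-approximate microcanonical channel operator
with respect to the constraints `(C^j, q_j)`. -/
def IsAMC {J : ℕ} (n : ℕ) (C : Fin J → Matrix (Fin dB × Fin dR) (Fin dB × Fin dR) ℂ)
    (q : Fin J → ℝ) (η ε δ y ν η' ε' δ' y' ν' : ℝ)
    (P : Matrix ((Fin n → Fin dB) × (Fin n → Fin dR))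
      ((Fin n → Fin dB) × (Fin n → Fin dR)) ℂ) : Prop :=
  (∀ E : Matrix ((Fin n → Fin dB) × (Fin n → Fin dR))
      ((Fin n → Fin dB) × (Fin n → Fin dR)) ℂ,
    E.PosSemidef → ptraceBn E = 1 →
    (∀ σ : Matrix (Fin dR) (Fin dR) ℂ, IsDensity σ → opGE σ y →
      (Matrix.trace ((1 - P) * iidOut E σ)).re ≤ ε) →
    ∀ j, ∀ σ : Matrix (Fin dR) (Fin dR) ℂ, IsDensity σ → opGE σ (ν * y) →
      (Matrix.trace
        (specProjOutside (q j - η) (q j + η) (avgObs n (Hwrt (C j) σ)) * iidOut E σ)).re ≤ δ)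
  ∧
  (∀ E : Matrix ((Fin n → Fin dB) × (Fin n → Fin dR))
      ((Fin n → Fin dB) × (Fin n → Fin dR)) ℂ,
    E.PosSemidef → ptraceBn E = 1 →
    (∀ j, ∀ σ : Matrix (Fin dR) (Fin dR) ℂ, IsDensity σ → opGE σ y' →
      (Matrix.trace
        (specProjOutside (q j - η') (q j + η') (avgObs n (Hwrt (C j) σ)) * iidOut E σ)).re ≤ δ') →
    ∀ σ : Matrix (Fin dR) (Fin dR) ℂ, IsDensity σ → opGE σ (ν' * y') →
      (Matrix.trace ((1 - P) * iidOut E σ)).re ≤ ε')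

theorem herm_decomp {n : Type*} [Fintype n] [DecidableEq n] {A : Matrix n n ℂ}
    (hA : A.IsHermitian) :
    A = (hA.eigenvectorUnitary : Matrix n n ℂ) *
      Matrix.diagonal (fun i => ((hA.eigenvalues i : ℝ) : ℂ)) *
      (hA.eigenvectorUnitary : Matrix n n ℂ)ᴴ := by
  have h := hA.spectral_theorem
  rw [Unitary.conjStarAlgAut_apply] at h
  exact h

theorem eu_left {n : Type*} [Fintype n] [DecidableEq n] {A : Matrix n n ℂ}
    (hA : A.IsHermitian) :
    (hA.eigenvectorUnitary : Matrix n n ℂ)ᴴ * (hA.eigenvectorUnitary : Matrix n n ℂ) = 1 :=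
  Unitary.coe_star_mul_self hA.eigenvectorUnitary

theorem eu_right {n : Type*} [Fintype n] [DecidableEq n] {A : Matrix n n ℂ}
    (hA : A.IsHermitian) :
    (hA.eigenvectorUnitary : Matrix n n ℂ) * (hA.eigenvectorUnitary : Matrix n n ℂ)ᴴ = 1 :=
  Unitary.coe_mul_star_self hA.eigenvectorUnitary

theorem diag_real_herm {n : Type*} [Fintype n] [DecidableEq n] (U : Matrix n n ℂ) (d : n → ℝ) :
    (U * Matrix.diagonal (fun i => (d i : ℂ)) * Uᴴ).IsHermitian := by
  unfold Matrix.IsHermitian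
  simp only [conjTranspose_mul, conjTranspose_conjTranspose, diagonal_conjTranspose, mul_assoc]
  congr 3
  ext i
  simp

/-- The functional calculus can be computed in any diagonalising orthonormal basis. -/
theorem hermCFC_conj {n : Type*} [Fintype n] [DecidableEq n] (f : ℝ → ℝ) (W : Matrix n n ℂ)
    (d : n → ℝ) (h1 : Wᴴ * W = 1) (h2 : W * Wᴴ = 1) (A : Matrix n n ℂ)
    (hAW : A = W * Matrix.diagonal (fun i => (d i : ℂ)) * Wᴴ) :
    hermCFC f A = W * Matrix.diagonal (fun i => (f (d i) : ℂ)) * Wᴴ := by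
  have hA : A.IsHermitian := hAW ▸ diag_real_herm W d
  rw [hermCFC, dif_pos hA, star_eq_conjTranspose]
  have hd := herm_decomp hA
  have ul := eu_left hA
  have ur := eu_right hA
  generalize (hA.eigenvectorUnitary : Matrix n n ℂ) = U at *
  generalize hA.eigenvalues = l at *
  have key : Matrix.diagonal (fun i => (l i : ℂ)) * (Uᴴ * W)
      = (Uᴴ * W) * Matrix.diagonal (fun i => (d i : ℂ)) := by
    have e1 : Uᴴ * A * W = Matrix.diagonal (fun i => (l i : ℂ)) * (Uᴴ * W) := by
      conv_lhs => rw [hd]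
      simp only [← mul_assoc, ul, one_mul]
    have e2 : Uᴴ * A * W = (Uᴴ * W) * Matrix.diagonal (fun i => (d i : ℂ)) := by
      conv_lhs => rw [hAW]
      simp only [mul_assoc, h1, mul_one]
    rw [← e1, e2]
  have key2 : Matrix.diagonal (fun i => (f (l i) : ℂ)) * (Uᴴ * W)
      = (Uᴴ * W) * Matrix.diagonal (fun i => (f (d i) : ℂ)) := by
    ext i j
    have := congrFun (congrFun key i) j
    rw [diagonal_mul, mul_diagonal] at this ⊢
    by_cases hz : (Uᴴ * W) i j = 0
    · simp [hz]
    · rw [mul_comm] at this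
      have h3 := mul_left_cancel₀ hz this
      have h4 : l i = d j := by exact_mod_cast h3
      rw [h4, mul_comm]
  calc U * Matrix.diagonal (fun i => (f (l i) : ℂ)) * Uᴴ
      = U * (Matrix.diagonal (fun i => (f (l i) : ℂ)) * (Uᴴ * W)) * Wᴴ := by
        simp only [mul_assoc, h2, mul_one]
    _ = W * Matrix.diagonal (fun i => (f (d i) : ℂ)) * Wᴴ := by
        rw [key2]
        simp only [← mul_assoc, ur, one_mul]

/-! ### Tensor products of families of matrices -/

/-- Tensor product of a family of matrices, with the factors reordered. -/
def famPow {dB dR n : ℕ} (F : Fin n → Matrix (Fin dB × Fin dR) (Fin dB × Fin dR) ℂ) :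
    Matrix ((Fin n → Fin dB) × (Fin n → Fin dR)) ((Fin n → Fin dB) × (Fin n → Fin dR)) ℂ :=
  Matrix.of fun p q => ∏ i : Fin n, F i (p.1 i, p.2 i) (q.1 i, q.2 i)

theorem sum_pair_prod {R : Type*} [CommSemiring R] {dB dR n : ℕ}
    (g : Fin n → Fin dB × Fin dR → R) :
    ∑ p : (Fin n → Fin dB) × (Fin n → Fin dR), ∏ i, g i (p.1 i, p.2 i) = ∏ i, ∑ a, g i a := by
  rw [Fintype.prod_sum]
  exact (Equiv.sum_comp (Equiv.arrowProdEquivProdArrow (Fin n) (fun _ => Fin dB)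
    (fun _ => Fin dR)) (fun p => ∏ i, g i (p.1 i, p.2 i))).symm

theorem famPow_mul {dB dR n : ℕ} (F G : Fin n → Matrix (Fin dB × Fin dR) (Fin dB × Fin dR) ℂ) :
    famPow F * famPow G = famPow (fun i => F i * G i) := by
  ext p q
  simp only [famPow, mul_apply, of_apply, ← Finset.prod_mul_distrib]
  exact sum_pair_prod (fun i a => F i (p.1 i, p.2 i) a * G i a (q.1 i, q.2 i))

theorem kronPow_eq {dB dR n : ℕ} (A : Matrix (Fin dB × Fin dR) (Fin dB × Fin dR) ℂ) :
    kronPow n A = famPow (fun _ => A) := rfl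

theorem kronPow_mul {dB dR n : ℕ} (A B : Matrix (Fin dB × Fin dR) (Fin dB × Fin dR) ℂ) :
    kronPow n A * kronPow n B = kronPow n (A * B) := famPow_mul _ _

theorem kronPow_conj {dB dR n : ℕ} (A : Matrix (Fin dB × Fin dR) (Fin dB × Fin dR) ℂ) :
    (kronPow n A)ᴴ = kronPow n Aᴴ := by
  ext p q
  simp [kronPow, conjTranspose_apply]

theorem kronPow_one {dB dR n : ℕ} :
    kronPow n (1 : Matrix (Fin dB × Fin dR) (Fin dB × Fin dR) ℂ) = 1 := by
  ext p q
  simp only [kronPow, of_apply, one_apply]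
  rw [Finset.prod_ite_zero]
  simp only [Finset.prod_const_one, Finset.mem_univ, true_imp_iff, Prod.ext_iff, funext_iff,
    forall_and]

theorem kronPow_posSemidef {dB dR n : ℕ} {A : Matrix (Fin dB × Fin dR) (Fin dB × Fin dR) ℂ}
    (hA : A.PosSemidef) : (kronPow n A).PosSemidef := by
  obtain ⟨B, rfl⟩ : ∃ B : Matrix (Fin dB × Fin dR) (Fin dB × Fin dR) ℂ, A = Bᴴ * B := by
    open scoped MatrixOrder in
    exact CStarAlgebra.nonneg_iff_eq_star_mul_self.mp hA.nonneg
  rw [← kronPow_mul, ← kronPow_conj]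
  exact posSemidef_conjTranspose_mul_self _

theorem kron_kpow {dB dR n : ℕ} (T : Matrix (Fin dR) (Fin dR) ℂ) :
    ((1 : Matrix (Fin n → Fin dB) (Fin n → Fin dB) ℂ) ⊗ₖ kpow n T)
      = kronPow n ((1 : Matrix (Fin dB) (Fin dB) ℂ) ⊗ₖ T) := by
  ext p q
  simp only [kronecker_apply, kpow, kronPow, of_apply, one_apply, Finset.prod_mul_distrib]
  have h : (∏ i, if p.1 i = q.1 i then (1 : ℂ) else 0) = if p.1 = q.1 then 1 else 0 := by
    rw [Finset.prod_ite_zero]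
    simp [funext_iff]
  rw [h, ← one_apply]
  rfl

theorem iidOut_kronPow {dB dR n : ℕ} (N : Matrix (Fin dB × Fin dR) (Fin dB × Fin dR) ℂ)
    (σ : Matrix (Fin dR) (Fin dR) ℂ) :
    iidOut (kronPow n N) σ = kronPow n (((1 : Matrix (Fin dB) (Fin dB) ℂ) ⊗ₖ matSqrt σ) * N *
          ((1 : Matrix (Fin dB) (Fin dB) ℂ) ⊗ₖ matSqrt σ)) := by
  rw [iidOut, kron_kpow, kronPow_mul, kronPow_mul]

theorem ptraceBn_kronPow {dB dR n : ℕ} (N : Matrix (Fin dB × Fin dR) (Fin dB × Fin dR) ℂ)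
    (hN : ptraceB N = 1) : ptraceBn (kronPow n N) = 1 := by
  ext g g'
  simp only [ptraceBn, kronPow, of_apply]
  rw [← Fintype.prod_sum (fun i b => N (b, g i) (b, g' i))]
  have : ∀ r r', ∑ b, N (b, r) (b, r') = (1 : Matrix (Fin dR) (Fin dR) ℂ) r r' := by
    intro r r'
    rw [← hN]; rfl
  simp only [this, one_apply]
  rw [Finset.prod_ite_zero]
  simp [funext_iff]

theorem embedAt_eq {dB dR n : ℕ} (i : Fin n) (H : Matrix (Fin dB × Fin dR) (Fin dB × Fin dR) ℂ) :
    embedAt i H = famPow (fun j => if j = i then H else 1) := by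
  ext p q
  simp only [embedAt, famPow, of_apply]
  rw [← Finset.mul_prod_erase _ _ (Finset.mem_univ i)]
  have : ∀ j ∈ Finset.univ.erase i, (if j = i then H else 1) (p.1 j, p.2 j) (q.1 j, q.2 j)
      = if p.1 j = q.1 j ∧ p.2 j = q.2 j then (1 : ℂ) else 0 := by
    intro j hj
    rw [if_neg (Finset.ne_of_mem_erase hj), one_apply]
    simp
  rw [Finset.prod_congr rfl this, Finset.prod_ite_zero]
  simp

theorem embedAt_diag {dB dR n : ℕ} (i : Fin n) (D : Fin dB × Fin dR → ℂ) :
    embedAt i (Matrix.diagonal D) = Matrix.diagonal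
      (fun p : (Fin n → Fin dB) × (Fin n → Fin dR) => D (p.1 i, p.2 i)) := by
  ext p q
  simp only [embedAt, of_apply, diagonal_apply]
  by_cases h : p = q
  · subst h; simp
  · rw [if_neg h]
    split_ifs with h1 h2
    · exfalso
      apply h
      have h3 : ∀ j, p.1 j = q.1 j ∧ p.2 j = q.2 j := by
        intro j
        by_cases hj : j = i
        · subst hj; simpa using h2
        · exact h1 j hj
      exact Prod.ext (funext fun j => (h3 j).1) (funext fun j => (h3 j).2)
    · rfl
    · rfl

theorem embedAt_conj {dB dR n : ℕ} (i : Fin n)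
    (U D : Matrix (Fin dB × Fin dR) (Fin dB × Fin dR) ℂ) (hU : U * Uᴴ = 1) :
    embedAt i (U * D * Uᴴ) = kronPow n U * embedAt i D * (kronPow n U)ᴴ := by
  rw [kronPow_conj, embedAt_eq, embedAt_eq, kronPow_eq, kronPow_eq, famPow_mul, famPow_mul]
  congr 1
  ext1 j
  split_ifs
  · rfl
  · rw [mul_one, hU]

theorem avgObs_conj {dB dR n : ℕ} (U : Matrix (Fin dB × Fin dR) (Fin dB × Fin dR) ℂ)
    (d : Fin dB × Fin dR → ℝ) (hU : U * Uᴴ = 1) :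
    avgObs n (U * Matrix.diagonal (fun a => (d a : ℂ)) * Uᴴ) = kronPow n U *
      Matrix.diagonal (fun p : (Fin n → Fin dB) × (Fin n → Fin dR) =>
        (((n : ℝ)⁻¹ * ∑ i, d (p.1 i, p.2 i) : ℝ) : ℂ)) * (kronPow n U)ᴴ := by
  simp only [avgObs, embedAt_conj _ _ _ hU, embedAt_diag]
  rw [← Finset.sum_mul, ← Finset.mul_sum, ← smul_mul_assoc, ← mul_smul_comm]
  congr 2
  ext p q
  by_cases h : p = q
  · subst h; simp [Matrix.sum_apply]
  · simp [Matrix.sum_apply, h]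

/-- Trace of a spectral function of the average observable, as a classical expectation. -/
theorem trace_cfc_avg {dB dR n : ℕ} (f : ℝ → ℝ)
    (U ρ : Matrix (Fin dB × Fin dR) (Fin dB × Fin dR) ℂ)
    (d : Fin dB × Fin dR → ℝ) (hU : U * Uᴴ = 1) (hU' : Uᴴ * U = 1) :
    Matrix.trace (hermCFC f (avgObs n (U * Matrix.diagonal (fun a => (d a : ℂ)) * Uᴴ))
      * kronPow n ρ) = ∑ p : (Fin n → Fin dB) × (Fin n → Fin dR),
        (f ((n : ℝ)⁻¹ * ∑ i, d (p.1 i, p.2 i)) : ℂ) *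
          ∏ i, (Uᴴ * ρ * U) (p.1 i, p.2 i) (p.1 i, p.2 i) := by
  rw [hermCFC_conj f (kronPow n U) (fun p : (Fin n → Fin dB) × (Fin n → Fin dR) =>
        ((n : ℝ)⁻¹ * ∑ i, d (p.1 i, p.2 i) : ℝ)) _ _ _ (avgObs_conj U d hU)]
  · rw [mul_assoc, mul_assoc, Matrix.trace_mul_comm, mul_assoc, mul_assoc, kronPow_conj,
      kronPow_mul, kronPow_mul, Matrix.trace]
    refine Finset.sum_congr rfl fun p _ => ?_
    rw [diag_apply, diagonal_mul, ← mul_assoc]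
    rfl
  · rw [kronPow_conj, kronPow_mul, hU', kronPow_one]
  · rw [kronPow_conj, kronPow_mul, hU, kronPow_one]

/-! ### Classical Hoeffding bound on a finite space -/

theorem hoeffding_mgf {α : Type*} [Fintype α] (p d : α → ℝ) (hp : ∀ a, 0 ≤ p a)
    (hp1 : ∑ a, p a = 1) (M q : ℝ) (hd : ∀ a, |d a| ≤ M) (hq : ∑ a, p a * d a = q) (t : ℝ) :
    ∑ a, p a * Real.exp (t * (d a - q)) ≤ Real.exp (M ^ 2 * t ^ 2 / 2) := by
  let P : PMF α := PMF.ofFintype (fun a => ENNReal.ofReal (p a)) (by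
    rw [← ENNReal.ofReal_sum_of_nonneg (fun a _ => hp a), hp1, ENNReal.ofReal_one])
  let _ : MeasurableSpace α := ⊤
  have hint : ∀ f : α → ℝ, ∫ a, f a ∂P.toMeasure = ∑ a, p a * f a := by
    intro f
    rw [PMF.integral_eq_sum]
    refine Finset.sum_congr rfl fun a _ => ?_
    simp [P, ENNReal.toReal_ofReal (hp a)]
  have h := (ProbabilityTheory.hasSubgaussianMGF_of_mem_Icc (μ := P.toMeasure) (X := d)
    (a := -M) (b := M) (measurable_from_top.aemeasurable)
    (Filter.Eventually.of_forall fun a => abs_le.mp (hd a))).mgf_le t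
  rw [ProbabilityTheory.mgf, hint, hint, hq] at h
  refine h.trans (le_of_eq ?_)
  congr 1
  have : ((‖M - -M‖₊ / 2) ^ 2 : NNReal) = (M ^ 2 : ℝ) := by
    push_cast
    rw [Real.norm_eq_abs, div_pow, sq_abs]
    ring
  rw [this]

theorem hoeffding_iid {dB dR n : ℕ} (hn : 1 ≤ n) (p d : Fin dB × Fin dR → ℝ) (hp : ∀ a, 0 ≤ p a)
    (hp1 : ∑ a, p a = 1) (M q η : ℝ) (hM : 0 ≤ M) (hη : 0 < η) (hd : ∀ a, |d a| ≤ M)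
    (hq : ∑ a, p a * d a = q) (δ : ℝ) (hδ : 0 < δ)
    (hpar : 2 * M ^ 2 * Real.log (2 / δ) ≤ n * η ^ 2) :
    ∑ x : (Fin n → Fin dB) × (Fin n → Fin dR),
      (if q - η ≤ (n : ℝ)⁻¹ * ∑ i, d (x.1 i, x.2 i) ∧ (n : ℝ)⁻¹ * ∑ i, d (x.1 i, x.2 i) ≤ q + η
        then (0 : ℝ) else 1) * ∏ i, p (x.1 i, x.2 i) ≤ δ := by
  have hn0 : (0 : ℝ) < n := by exact_mod_cast hn
  rcases hM.eq_or_lt with rfl | hMpos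
  · have hd0 : ∀ a, d a = 0 := fun a => abs_eq_zero.mp (le_antisymm (hd a) (abs_nonneg _))
    have hq0 : q = 0 := by rw [← hq]; simp [hd0]
    subst hq0
    simp [hd0, hη.le, hδ.le]
  · set t : ℝ := η / M ^ 2 with ht
    have htpos : 0 < t := by positivity
    have hexp : ∀ s : ℝ, ∑ x : (Fin n → Fin dB) × (Fin n → Fin dR),
        (∏ i, p (x.1 i, x.2 i) * Real.exp (s * (d (x.1 i, x.2 i) - q)))
          ≤ Real.exp (M ^ 2 * s ^ 2 / 2) ^ n := by
      intro s
      rw [sum_pair_prod (fun _ a => p a * Real.exp (s * (d a - q)))]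
      rw [Finset.prod_const, Finset.card_univ, Fintype.card_fin]
      exact pow_le_pow_left₀ (Finset.sum_nonneg fun a _ => mul_nonneg (hp a) (Real.exp_pos _).le)
        (hoeffding_mgf p d hp hp1 M q hd hq s) n
    have hpt : ∀ x : (Fin n → Fin dB) × (Fin n → Fin dR),
      (if q - η ≤ (n : ℝ)⁻¹ * ∑ i, d (x.1 i, x.2 i) ∧ (n : ℝ)⁻¹ * ∑ i, d (x.1 i, x.2 i) ≤ q + η
        then (0 : ℝ) else 1) * ∏ i, p (x.1 i, x.2 i) ≤
        Real.exp (-(n * t * η)) *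
          (∏ i, p (x.1 i, x.2 i) * Real.exp (t * (d (x.1 i, x.2 i) - q))) +
        Real.exp (-(n * t * η)) *
          (∏ i, p (x.1 i, x.2 i) * Real.exp (-t * (d (x.1 i, x.2 i) - q))) := by
      intro x
      have hpp : 0 ≤ ∏ i, p (x.1 i, x.2 i) := Finset.prod_nonneg fun i _ => hp _
      simp only [Finset.prod_mul_distrib, ← Real.exp_sum, ← Finset.mul_sum,
        Finset.sum_sub_distrib, Finset.sum_const, Finset.card_univ, Fintype.card_fin, nsmul_eq_mul]
      set S := ∑ i, d (x.1 i, x.2 i) with hS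
      set Q := ∏ i, p (x.1 i, x.2 i) with hQ
      have e1 : ∀ u : ℝ, Real.exp (-(n * t * η)) * (Q * Real.exp u)
          = Real.exp (u - n * t * η) * Q := by
        intro u
        rw [sub_eq_add_neg, Real.exp_add]; ring
      rw [e1, e1, ← add_mul]
      refine mul_le_mul_of_nonneg_right ?_ hpp
      have a1 := Real.exp_pos (t * (S - n * q) - n * t * η)
      have a2 := Real.exp_pos (-t * (S - n * q) - n * t * η)
      split_ifs with h
      · linarith
      · have hSn : S = n * ((n : ℝ)⁻¹ * S) := by field_simp
        rw [not_and_or, not_le, not_le] at h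
        generalize (n : ℝ)⁻¹ * S = z at h hSn
        rcases h with h | h
        · have : 1 ≤ Real.exp (-t * (S - n * q) - n * t * η) := by
            apply Real.one_le_exp
            rw [hSn]
            have : 0 ≤ (n * t) * (q - η - z) := by
              apply mul_nonneg (by positivity); linarith
            linarith
          linarith
        · have : 1 ≤ Real.exp (t * (S - n * q) - n * t * η) := by
            apply Real.one_le_exp
            rw [hSn]
            have : 0 ≤ (n * t) * (z - (q + η)) := by
              apply mul_nonneg (by positivity); linarith
            linarith
          linarith
    refine (Finset.sum_le_sum fun x _ => hpt x).trans ?_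
    rw [Finset.sum_add_distrib, ← Finset.mul_sum, ← Finset.mul_sum]
    have b1 := mul_le_mul_of_nonneg_left (hexp t) (Real.exp_pos (-(n * t * η))).le
    have b2 := mul_le_mul_of_nonneg_left (hexp (-t)) (Real.exp_pos (-(n * t * η))).le
    have b3 : Real.exp (-(n * t * η)) * Real.exp (M ^ 2 * t ^ 2 / 2) ^ n
        = Real.exp (-(n * η ^ 2 / (2 * M ^ 2))) := by
      rw [← Real.exp_nat_mul, ← Real.exp_add]
      congr 1
      rw [ht]; field_simp; ring
    have b4 : Real.exp (-(n * η ^ 2 / (2 * M ^ 2))) ≤ δ / 2 := by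
      rw [← Real.le_log_iff_exp_le (by positivity)]
      have : Real.log (δ / 2) = - Real.log (2 / δ) := by
        rw [← Real.log_inv, inv_div]
      rw [this, neg_le_neg_iff, le_div_iff₀ (by positivity)]
      linarith
    rw [neg_sq] at b2
    rw [b3] at b1 b2
    linarith

/-! ### Single-copy operator estimates -/

theorem sigma_facts {d : ℕ} (σ : Matrix (Fin d) (Fin d) ℂ) (hσ : σ.IsHermitian) (y : ℝ)
    (hy : 0 < y) (hge : opGE σ y) :
    (matSqrt σ)ᴴ = matSqrt σ ∧ (matPinvSqrt σ)ᴴ = matPinvSqrt σ ∧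
    matSqrt σ * matPinvSqrt σ = 1 ∧ matPinvSqrt σ * matSqrt σ = 1 ∧
    matSqrt σ * matSqrt σ = σ := by
  have hd := herm_decomp hσ
  have ul := eu_left hσ
  have ur := eu_right hσ
  have hs : matSqrt σ = _ := hermCFC_conj Real.sqrt _ _ ul ur _ hd
  have hps : matPinvSqrt σ = _ := hermCFC_conj (fun x => Real.sqrt x⁻¹) _ _ ul ur _ hd
  have hpos : ∀ i, y ≤ hσ.eigenvalues i := by
    intro i
    have h := (hge.conjTranspose_mul_mul_same
      (hσ.eigenvectorUnitary : Matrix (Fin d) (Fin d) ℂ)).diag_nonneg (i := i)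
    generalize (hσ.eigenvectorUnitary : Matrix (Fin d) (Fin d) ℂ) = U at *
    have e : Uᴴ * (σ - (y : ℂ) • 1) * U
        = Matrix.diagonal (fun i => ((hσ.eigenvalues i : ℝ) : ℂ)) - (y : ℂ) • 1 := by
      conv_lhs => rw [hd]
      simp only [mul_sub, sub_mul, mul_smul_comm, smul_mul_assoc, mul_one, ul]
      simp only [mul_assoc, ul, mul_one]
      simp only [← mul_assoc, ul, one_mul]
    rw [e] at h
    simp only [Matrix.sub_apply, Matrix.smul_apply, diagonal_apply_eq, one_apply_eq, smul_eq_mul, mul_one] at h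
    rw [← Complex.ofReal_sub, Complex.zero_le_real] at h
    linarith
  have hmul : ∀ (U : Matrix (Fin d) (Fin d) ℂ), Uᴴ * U = 1 → ∀ a b : Fin d → ℂ,
      (U * diagonal a * Uᴴ) * (U * diagonal b * Uᴴ) = U * diagonal (fun i => a i * b i) * Uᴴ := by
    intro U hU a b
    rw [← diagonal_mul_diagonal]
    calc (U * diagonal a * Uᴴ) * (U * diagonal b * Uᴴ)
        = U * diagonal a * (Uᴴ * U) * diagonal b * Uᴴ := by simp only [mul_assoc]
      _ = _ := by rw [hU]; simp only [mul_assoc, mul_one, one_mul]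
  have hone : ∀ i, Real.sqrt (hσ.eigenvalues i) * Real.sqrt (hσ.eigenvalues i)⁻¹ = 1 := by
    intro i
    have := hpos i
    rw [← Real.sqrt_mul (by linarith), mul_inv_cancel₀ (by linarith), Real.sqrt_one]
  have hsq : ∀ i, Real.sqrt (hσ.eigenvalues i) * Real.sqrt (hσ.eigenvalues i)
      = hσ.eigenvalues i := by
    intro i
    have := hpos i
    exact Real.mul_self_sqrt (by linarith)
  refine ⟨?_, ?_, ?_, ?_, ?_⟩
  · rw [hs]; exact diag_real_herm _ _
  · rw [hps]; exact diag_real_herm _ _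
  · rw [hs, hps, hmul _ ul]
    simp only [← Complex.ofReal_mul, hone]
    simp [ur]
  · rw [hs, hps, hmul _ ul]
    simp only [← Complex.ofReal_mul, mul_comm, hone]
    simp [ur]
  · rw [hs, hmul _ ul]
    simp only [← Complex.ofReal_mul, hsq]
    exact hd.symm

theorem diag_posSemidef_conj {n : Type*} [Fintype n] [DecidableEq n] (U : Matrix n n ℂ)
    (d : n → ℝ) (hd : ∀ i, 0 ≤ d i) :
    (U * Matrix.diagonal (fun i => (d i : ℂ)) * Uᴴ).PosSemidef := by
  refine PosSemidef.mul_mul_conjTranspose_same (PosSemidef.diagonal fun i => ?_) U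
  exact Complex.zero_le_real.mpr (hd i)

theorem eig_le_hermNorm {n : Type*} [Fintype n] [DecidableEq n] {A : Matrix n n ℂ}
    (hA : A.IsHermitian) (i : n) : |hA.eigenvalues i| ≤ hermNorm A := by
  rw [hermNorm, dif_pos hA]
  exact le_ciSup (f := fun i => |hA.eigenvalues i|) (Set.finite_range _).bddAbove i

theorem hermNorm_nonneg {n : Type*} [Fintype n] [DecidableEq n] (A : Matrix n n ℂ) :
    0 ≤ hermNorm A := by
  unfold hermNorm
  split_ifs
  · exact Real.iSup_nonneg fun i => abs_nonneg _
  · exact le_rfl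

theorem hermNorm_bound {n : Type*} [Fintype n] [DecidableEq n] {A : Matrix n n ℂ}
    (hA : A.IsHermitian) (s : ℝ) (hs : |s| = 1) :
    ((hermNorm A : ℂ) • (1 : Matrix n n ℂ) - (s : ℂ) • A).PosSemidef := by
  have hd := herm_decomp hA
  have ur := eu_right hA
  have := diag_posSemidef_conj (hA.eigenvectorUnitary : Matrix n n ℂ)
    (fun i => hermNorm A - s * hA.eigenvalues i) (fun i => by
      have h1 := eig_le_hermNorm hA i
      have h2 : |s * hA.eigenvalues i| ≤ hermNorm A := by rw [abs_mul, hs, one_mul]; exact h1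
      linarith [le_abs_self (s * hA.eigenvalues i)])
  convert this using 1
  have e : Matrix.diagonal (fun i => ((hermNorm A - s * hA.eigenvalues i : ℝ) : ℂ))
      = (hermNorm A : ℂ) • (1 : Matrix n n ℂ)
        - (s : ℂ) • Matrix.diagonal (fun i => ((hA.eigenvalues i : ℝ) : ℂ)) := by
    ext i j
    by_cases h : i = j
    · subst h; simp
    · simp [h]
  rw [e, mul_sub, sub_mul, mul_smul_comm, mul_smul_comm, smul_mul_assoc, smul_mul_assoc, mul_one,
    ur, ← hd]

theorem Hwrt_herm {dB dR : ℕ} {C : Matrix (Fin dB × Fin dR) (Fin dB × Fin dR) ℂ}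
    (hC : C.IsHermitian) (σ : Matrix (Fin dR) (Fin dR) ℂ)
    (hT : (matPinvSqrt σ)ᴴ = matPinvSqrt σ) : (Hwrt C σ).IsHermitian := by
  unfold Matrix.IsHermitian Hwrt
  simp only [conjTranspose_mul, conjTranspose_kronecker, conjTranspose_one, hT, hC.eq, mul_assoc]

theorem Hwrt_bound {dB dR : ℕ} {C : Matrix (Fin dB × Fin dR) (Fin dB × Fin dR) ℂ}
    (hC : C.IsHermitian) (σ : Matrix (Fin dR) (Fin dR) ℂ) (hσ : σ.IsHermitian) (y : ℝ)
    (hy : 0 < y) (hge : opGE σ y) (s : ℝ) (hs : |s| = 1) :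
    (((hermNorm C / y : ℝ) : ℂ) • (1 : Matrix (Fin dB × Fin dR) (Fin dB × Fin dR) ℂ)
      - (s : ℂ) • Hwrt C σ).PosSemidef := by
  obtain ⟨hS, hT, hST, hTS, hSS⟩ := sigma_facts σ hσ y hy hge
  have h1 := (hermNorm_bound hC s hs).mul_mul_conjTranspose_same
    ((1 : Matrix (Fin dB) (Fin dB) ℂ) ⊗ₖ matPinvSqrt σ)
  have h2 := hge.mul_mul_conjTranspose_same (matPinvSqrt σ)
  have h3 := (PosSemidef.one (n := Fin dB) (R := ℂ)).kronecker h2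
  have h4 : (0 : ℂ) ≤ ((hermNorm C / y : ℝ) : ℂ) :=
    Complex.zero_le_real.mpr (div_nonneg (hermNorm_nonneg C) hy.le)
  have h5 := (h3.smul h4).add h1
  refine (congrArg Matrix.PosSemidef ?_).mpr h5
  have e1 : matPinvSqrt σ * (σ - (y : ℂ) • 1) * (matPinvSqrt σ)ᴴ
      = 1 - (y : ℂ) • (matPinvSqrt σ * matPinvSqrt σ) := by
    have : matPinvSqrt σ * σ * matPinvSqrt σ = 1 := by
      conv_lhs => enter [1, 2]; rw [← hSS]
      rw [← mul_assoc, hTS, one_mul, hST]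
    rw [hT, mul_sub, sub_mul, this, mul_smul_comm, smul_mul_assoc, mul_one]
  rw [e1]
  have e2 : ((1 : Matrix (Fin dB) (Fin dB) ℂ) ⊗ₖ matPinvSqrt σ)ᴴ
      = (1 : Matrix (Fin dB) (Fin dB) ℂ) ⊗ₖ matPinvSqrt σ := by
    rw [conjTranspose_kronecker, conjTranspose_one, hT]
  rw [e2, mul_sub, sub_mul, mul_smul_comm, mul_smul_comm, smul_mul_assoc, smul_mul_assoc, mul_one,
    ← mul_kronecker_mul, one_mul]
  have e3 : (1 : Matrix (Fin dB) (Fin dB) ℂ) ⊗ₖ (1 - (y : ℂ) • (matPinvSqrt σ * matPinvSqrt σ))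
      = 1 - (y : ℂ) • ((1 : Matrix (Fin dB) (Fin dB) ℂ) ⊗ₖ (matPinvSqrt σ * matPinvSqrt σ)) := by
    rw [← kronecker_smul, ← one_kronecker_one (m := Fin dB) (n := Fin dR)]
    ext ⟨a, b⟩ ⟨c, e⟩
    simp only [kronecker_apply, Matrix.sub_apply, mul_sub]
  rw [e3, smul_sub, smul_smul]
  have e4 : ((hermNorm C / y : ℝ) : ℂ) * (y : ℂ) = (hermNorm C : ℂ) := by
    rw [← Complex.ofReal_mul, div_mul_cancel₀ _ hy.ne']
  rw [e4]
  unfold Hwrt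
  abel

theorem Hwrt_eig {dB dR : ℕ} {C : Matrix (Fin dB × Fin dR) (Fin dB × Fin dR) ℂ}
    (hC : C.IsHermitian) (σ : Matrix (Fin dR) (Fin dR) ℂ) (hσ : σ.IsHermitian) (y : ℝ)
    (hy : 0 < y) (hge : opGE σ y) (hH : (Hwrt C σ).IsHermitian) (a : Fin dB × Fin dR) :
    |hH.eigenvalues a| ≤ hermNorm C / y := by
  have main : ∀ s : ℝ, |s| = 1 → s * hH.eigenvalues a ≤ hermNorm C / y := by
    intro s hs
    have h := ((Hwrt_bound hC σ hσ y hy hge s hs).conjTranspose_mul_mul_same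
      (hH.eigenvectorUnitary : Matrix (Fin dB × Fin dR) (Fin dB × Fin dR) ℂ)).diag_nonneg (i := a)
    have hd := herm_decomp hH
    have ul := eu_left hH
    generalize (hH.eigenvectorUnitary : Matrix (Fin dB × Fin dR) (Fin dB × Fin dR) ℂ) = U at *
    have e0 : Uᴴ * Hwrt C σ * U = Matrix.diagonal (fun i => ((hH.eigenvalues i : ℝ) : ℂ)) := by
      conv_lhs => rw [hd]
      simp only [mul_assoc, ul, mul_one]
      simp only [← mul_assoc, ul, one_mul]
    rw [mul_sub, sub_mul, mul_smul_comm, smul_mul_assoc, mul_one, ul, mul_smul_comm,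
      smul_mul_assoc, e0] at h
    simp only [Matrix.sub_apply, Matrix.smul_apply, diagonal_apply_eq, one_apply_eq, smul_eq_mul, mul_one] at h
    rw [← Complex.ofReal_mul, ← Complex.ofReal_sub, Complex.zero_le_real] at h
    linarith
  rw [abs_le]
  have m1 := main 1 (by simp)
  have m2 := main (-1) (by simp)
  constructor <;> linarith

theorem trace_choi {dB dR : ℕ} {N : Matrix (Fin dB × Fin dR) (Fin dB × Fin dR) ℂ}
    (hN : ptraceB N = 1) (σ : Matrix (Fin dR) (Fin dR) ℂ) :
    Matrix.trace (((1 : Matrix (Fin dB) (Fin dB) ℂ) ⊗ₖ σ) * N) = Matrix.trace σ := by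
  have : ∀ r r', ∑ b, N (b, r) (b, r') = (1 : Matrix (Fin dR) (Fin dR) ℂ) r r' := by
    intro r r'
    rw [← hN]; rfl
  simp only [Matrix.trace, diag_apply, mul_apply, Fintype.sum_prod_type, kronecker_apply,
    one_apply, ite_mul, one_mul, zero_mul, Finset.sum_ite_irrel, Finset.sum_const_zero,
    Finset.sum_ite_eq, Finset.mem_univ, if_true]
  rw [Finset.sum_comm]
  refine Finset.sum_congr rfl fun r _ => ?_
  rw [Finset.sum_comm]
  simp only [← Finset.mul_sum, this, one_apply]
  simp

theorem concentration {dB dR n : ℕ} (hn : 1 ≤ n)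
    (C : Matrix (Fin dB × Fin dR) (Fin dB × Fin dR) ℂ)
    (hC : C.IsHermitian) (q η δ y : ℝ) (hη : 0 < η) (hδ : 0 < δ) (hy : 0 < y)
    (N : Matrix (Fin dB × Fin dR) (Fin dB × Fin dR) ℂ) (hN : IsChoi N)
    (hNq : Matrix.trace (C * N) = (q : ℂ))
    (hpar : 2 * hermNorm C ^ 2 * Real.log (2 / δ) ≤ n * η ^ 2 * y ^ 2)
    (σ : Matrix (Fin dR) (Fin dR) ℂ) (hσ : IsDensity σ) (hge : opGE σ y) :
    (Matrix.trace (specProjOutside (q - η) (q + η) (avgObs n (Hwrt C σ)) *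
      iidOut (kronPow n N) σ)).re ≤ δ := by
  have hσh := hσ.1.isHermitian
  obtain ⟨hS, hT, hST, hTS, hSS⟩ := sigma_facts σ hσh y hy hge
  have hH := Hwrt_herm (dB := dB) hC σ hT
  rw [iidOut_kronPow]
  set S1 := (1 : Matrix (Fin dB) (Fin dB) ℂ) ⊗ₖ matSqrt σ with hS1
  set T1 := (1 : Matrix (Fin dB) (Fin dB) ℂ) ⊗ₖ matPinvSqrt σ with hT1
  have hS1h : S1ᴴ = S1 := by rw [hS1, conjTranspose_kronecker, conjTranspose_one, hS]
  have hST1 : S1 * T1 = 1 := by rw [hS1, hT1, ← mul_kronecker_mul, hST, one_mul, one_kronecker_one]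
  have hTS1 : T1 * S1 = 1 := by rw [hS1, hT1, ← mul_kronecker_mul, hTS, one_mul, one_kronecker_one]
  set ρ := S1 * N * S1 with hρ
  have hρpos : ρ.PosSemidef := by
    have := hN.1.mul_mul_conjTranspose_same S1
    rwa [hS1h] at this
  have hρtr : Matrix.trace ρ = 1 := by
    rw [hρ, Matrix.trace_mul_comm, ← mul_assoc, hS1, ← mul_kronecker_mul, hSS, one_mul,
      trace_choi hN.2, hσ.2]
  have hρH : Matrix.trace (Hwrt C σ * ρ) = (q : ℂ) := by
    have : Hwrt C σ * ρ = T1 * C * N * S1 := by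
      rw [hρ, Hwrt, ← hT1]
      calc T1 * C * T1 * (S1 * N * S1) = T1 * C * (T1 * S1) * N * S1 := by simp only [mul_assoc]
        _ = _ := by rw [hTS1, mul_one]
    rw [this, Matrix.trace_mul_comm, ← mul_assoc, ← mul_assoc, hST1, one_mul, hNq]
  have hd := herm_decomp hH
  have ul := eu_left hH
  have ur := eu_right hH
  have heig := Hwrt_eig hC σ hσh y hy hge hH
  generalize (hH.eigenvectorUnitary : Matrix (Fin dB × Fin dR) (Fin dB × Fin dR) ℂ) = U at *
  generalize hH.eigenvalues = d at *
  rw [specProjOutside, hd, trace_cfc_avg _ U ρ d ur ul]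
  have hRpos := hρpos.conjTranspose_mul_mul_same U
  set p : Fin dB × Fin dR → ℝ := fun a => ((Uᴴ * ρ * U) a a).re with hp
  have hpc : ∀ a, (Uᴴ * ρ * U) a a = (p a : ℂ) := by
    intro a
    have h := hRpos.diag_nonneg (i := a)
    rw [Complex.le_def] at h
    apply Complex.ext
    · simp [hp]
    · simpa using h.2.symm
  have hp0 : ∀ a, 0 ≤ p a := by
    intro a
    have h := hRpos.diag_nonneg (i := a)
    rw [Complex.le_def] at h
    exact h.1
  have hp1 : ∑ a, p a = 1 := by
    have h : Matrix.trace (Uᴴ * ρ * U) = 1 := by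
      rw [Matrix.trace_mul_comm, ← mul_assoc, ur, one_mul, hρtr]
    simp only [Matrix.trace, diag_apply, hpc] at h
    exact_mod_cast h
  have hpq : ∑ a, p a * d a = q := by
    have h : Matrix.trace (Matrix.diagonal (fun a => (d a : ℂ)) * (Uᴴ * ρ * U)) = (q : ℂ) := by
      rw [← hρH]
      conv_rhs => rw [hd]
      rw [← mul_assoc, Matrix.trace_mul_comm]
      simp only [mul_assoc]
    simp only [Matrix.trace, diag_apply, diagonal_mul, hpc] at h
    have h' : ∑ a, d a * p a = q := by exact_mod_cast h
    rw [← h']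
    exact Finset.sum_congr rfl fun a _ => mul_comm _ _
  have := hoeffding_iid hn p d hp0 hp1 (hermNorm C / y) q η
    (div_nonneg (hermNorm_nonneg C) hy.le) hη heig hpq δ hδ (by
      rw [div_pow, mul_div_assoc', div_mul_eq_mul_div, div_le_iff₀ (by positivity)]
      exact hpar)
  refine le_trans (le_of_eq ?_) this
  simp only [hpc]
  rw [Complex.re_sum]
  refine Finset.sum_congr rfl fun x _ => ?_
  rw [← Complex.ofReal_prod, ← Complex.ofReal_mul, Complex.ofReal_re]

/-- **Approximate microcanonical channel operators capture i.i.d. channels with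
compatible constraints.** -/
theorem amc_captures_iid_channels
    {dB dR J : ℕ} (hdB : 1 ≤ dB) (hdR : 1 ≤ dR) (n : ℕ) (hn : 1 ≤ n)
    (C : Fin J → Matrix (Fin dB × Fin dR) (Fin dB × Fin dR) ℂ)
    (hC : ∀ j, (C j).IsHermitian) (q : Fin J → ℝ)
    (η ε δ y ν η' ε' δ' y' ν' : ℝ)
    (hη : 0 < η) (hε : 0 < ε) (hδ : 0 < δ) (hy : 0 < y) (hν : 0 < ν)
    (hη' : 0 < η') (hε' : 0 < ε') (hδ' : 0 < δ') (hy' : 0 < y') (hν' : 0 < ν')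
    (P : Matrix ((Fin n → Fin dB) × (Fin n → Fin dR))
      ((Fin n → Fin dB) × (Fin n → Fin dR)) ℂ)
    (hP0 : P.PosSemidef) (hP1 : (1 - P).PosSemidef)
    (hAMC : IsAMC n C q η ε δ y ν η' ε' δ' y' ν' P)
    -- a single-copy Choi matrix satisfying the constraints exactly
    (N : Matrix (Fin dB × Fin dR) (Fin dB × Fin dR) ℂ) (hN : IsChoi N)
    (hNq : ∀ j, Matrix.trace (C j * N) = (q j : ℂ))
    -- the assumption `2‖C^j‖² log(2/δ′) ≤ n η′² y′²`
    (hparams : ∀ j, 2 * hermNorm (C j) ^ 2 * Real.log (2 / δ') ≤ n * η' ^ 2 * y' ^ 2) :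
    ∀ σ : Matrix (Fin dR) (Fin dR) ℂ, IsDensity σ → opGE σ (ν' * y') →
      (Matrix.trace ((1 - P) *
        kronPow n (((1 : Matrix (Fin dB) (Fin dB) ℂ) ⊗ₖ matSqrt σ) * N *
          ((1 : Matrix (Fin dB) (Fin dB) ℂ) ⊗ₖ matSqrt σ)))).re ≤ ε' := by
  intro σ hσ hge
  rw [← iidOut_kronPow]
  exact hAMC.2 (kronPow n N) (kronPow_posSemidef hN.1) (ptraceBn_kronPow N hN.2)
    (fun j τ hτ hτge => concentration hn (C j) (hC j) (q j) η' δ' y' hη' hδ' hy' N hN (hNq j)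
      (hparams j) τ hτ hτge) σ hσ hge

end ThermalPaper
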